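/- arXiv:1905.01350 — 7 statements merged into one kernel-verified Lean document; each statement's English description precedes it below -/
import Mathlib

section
/- For the Little model with parameters θ = (w,b), every transition probability is bounded below: for all x⁰, x¹ ∈ {0,1}^n, P_θ(x⁰,x¹) ≥ σ(−‖w‖_∞ − ‖b‖_∞)^n, where ‖w‖_∞ is the operator ∞-norm of the matrix w (the maximum over i of Σ_j |w_{i,j}|) and ‖b‖_∞ = max_i |b_i|. -/
open Finset

/-- The logistic sigmoid `σ(x) = 1/(1+exp(−x))`. -/
noncomputable def logistic (x : ℝ) : ℝ := 1 / (1 + Real.exp (-x))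

/-- The input to node `i` at state `x`: `u_i(x,(w,b)) = ∑ j, w i j * x j + b i`. -/
noncomputable def nodeInput {n : ℕ} (w : Fin n → Fin n → ℝ) (b : Fin n → ℝ)
    (x : Fin n → Fin 2) (i : Fin n) : ℝ :=
  ∑ j, w i j * ((x j : ℕ) : ℝ) + b i

/-- The transition kernel of the Little model:
`P_θ(x⁰,x¹) = ∏ i, σ(u_i(x⁰,θ))^{x¹_i} (1 − σ(u_i(x⁰,θ)))^{1 − x¹_i}`. -/
noncomputable def littleKernel {n : ℕ} (w : Fin n → Fin n → ℝ) (b : Fin n → ℝ)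
    (x0 x1 : Fin n → Fin 2) : ℝ :=
  ∏ i, logistic (nodeInput w b x0 i) ^ ((x1 i : ℕ)) *
    (1 - logistic (nodeInput w b x0 i)) ^ (1 - (x1 i : ℕ))

theorem logistic_eq_sigmoid (x : ℝ) : logistic x = Real.sigmoid x := by
  rw [logistic, Real.sigmoid_def, one_div]

theorem abs_nodeInput_le {n : ℕ} (w : Fin n → Fin n → ℝ) (b : Fin n → ℝ)
    (x : Fin n → Fin 2) (i : Fin n) :
    |nodeInput w b x i| ≤ (⨆ i : Fin n, ∑ j, |w i j|) + ⨆ i : Fin n, |b i| := by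
  have hw : ∑ j, |w i j| ≤ ⨆ i : Fin n, ∑ j, |w i j| :=
    le_ciSup (f := fun i : Fin n => ∑ j, |w i j|) (Set.finite_range _).bddAbove i
  have hb : |b i| ≤ ⨆ i : Fin n, |b i| :=
    le_ciSup (f := fun i : Fin n => |b i|) (Set.finite_range _).bddAbove i
  have hx : |∑ j, w i j * ((x j : ℕ) : ℝ)| ≤ ∑ j, |w i j| := by
    refine (Finset.abs_sum_le_sum_abs _ _).trans (Finset.sum_le_sum fun j _ => ?_)
    have hxj : ((x j : ℕ) : ℝ) ≤ 1 := by exact_mod_cast Nat.le_of_lt_succ (x j).isLt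
    rw [abs_mul, Nat.abs_cast]
    exact mul_le_of_le_one_right (abs_nonneg _) hxj
  exact (abs_add_le _ _).trans (add_le_add (hx.trans hw) hb)

/-- Both values of a node with input `u` have probability at least `σ(c)` when `c ≤ -|u|`. -/
theorem logistic_le_node_probability {c u : ℝ} (h : c ≤ -|u|) (k : Fin 2) :
    logistic c ≤ logistic u ^ (k : ℕ) * (1 - logistic u) ^ (1 - (k : ℕ)) := by
  simp only [logistic_eq_sigmoid, ← Real.sigmoid_neg]
  fin_cases k
  · simpa using Real.sigmoid_le (h.trans (neg_le_neg (le_abs_self u)))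
  · simpa using Real.sigmoid_le (h.trans (neg_abs_le u))

/-- For the Little model with parameters `θ = (w, b)`, every
transition probability is bounded below: for all `x⁰, x¹ ∈ {0,1}^n`,
`P_θ(x⁰,x¹) ≥ σ(−‖w‖_∞ − ‖b‖_∞)^n`, where `‖w‖_∞ = max_i ∑ j |w i j|`
(the operator ∞-norm) and `‖b‖_∞ = max_i |b i|`. -/
theorem littleKernel_lower_bound {n : ℕ}
    (w : Fin n → Fin n → ℝ) (b : Fin n → ℝ)
    (x0 x1 : Fin n → Fin 2) :
    logistic (-(⨆ i : Fin n, ∑ j, |w i j|) - ⨆ i : Fin n, |b i|) ^ n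
      ≤ littleKernel w b x0 x1 := by
  have hle (i : Fin n) := logistic_le_node_probability
    (c := -(⨆ i : Fin n, ∑ j, |w i j|) - ⨆ i : Fin n, |b i|)
    (by linarith [abs_nodeInput_le w b x0 i]) (x1 i)
  have hprod := Finset.prod_le_prod (s := Finset.univ)
    (fun _ _ => (logistic_eq_sigmoid _).symm ▸ Real.sigmoid_nonneg _) fun i _ => hle i
  simpa [littleKernel] using hprod
end

section
/- For the Little model with parameters θ = (w,b), the transition kernel P_θ is a contraction for the total variation distance with coefficient 1 − σ(−‖w‖_∞ − ‖b‖_∞)^n: for any two probability measures μ₁, μ₂ on {0,1}^n, d_TV(μ₁P_θ, μ₂P_θ) ≤ (1 − σ(−‖w‖_∞ − ‖b‖_∞)^n)·d_TV(μ₁, μ₂), where ‖w‖_∞ is the operator ∞-norm of the matrix w and ‖b‖_∞ = max_i |b_i|. -/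
open Finset

theorem logistic_pos (x : ℝ) : 0 < logistic x := by
  unfold logistic; positivity

theorem logistic_mono : Monotone logistic := by
  intro x y h
  unfold logistic
  gcongr

theorem one_sub_logistic (x : ℝ) : 1 - logistic x = logistic (-x) := by
  unfold logistic
  rw [neg_neg, Real.exp_neg]
  have := Real.exp_pos x
  field_simp
  ring

theorem logistic_pow_le_littleKernel {n : ℕ} (w : Fin n → Fin n → ℝ) (b : Fin n → ℝ)
    (x y : Fin n → Fin 2) :
    logistic (-(⨆ i : Fin n, ∑ j, |w i j|) - ⨆ i : Fin n, |b i|) ^ n ≤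
      littleKernel w b x y := by
  have h : ∏ _i : Fin n, logistic (-(⨆ i : Fin n, ∑ j, |w i j|) - ⨆ i : Fin n, |b i|) ≤
      littleKernel w b x y := by
    refine prod_le_prod (fun _ _ => (logistic_pos _).le) fun i _ => ?_
    have hu := abs_le.1 (abs_nodeInput_le w b x i)
    rw [one_sub_logistic]
    generalize y i = a
    fin_cases a
    · simpa using logistic_mono (by linarith)
    · simpa using logistic_mono (by linarith)
  simpa using h

theorem littleKernel_nonneg {n : ℕ} (w : Fin n → Fin n → ℝ) (b : Fin n → ℝ)
    (x y : Fin n → Fin 2) : 0 ≤ littleKernel w b x y :=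
  (pow_pos (logistic_pos _) n).le.trans (logistic_pow_le_littleKernel w b x y)

theorem sum_littleKernel {n : ℕ} (w : Fin n → Fin n → ℝ) (b : Fin n → ℝ)
    (x : Fin n → Fin 2) : ∑ y, littleKernel w b x y = 1 := by
  have h := Fintype.prod_sum fun (i : Fin n) (a : Fin 2) =>
    logistic (nodeInput w b x i) ^ (a : ℕ) * (1 - logistic (nodeInput w b x i)) ^ (1 - (a : ℕ))
  unfold littleKernel
  rw [← h]
  simp [Fin.sum_univ_two]

/-- A signed measure of total mass zero, bounded by `T` on every set, integrates a function of
oscillation at most `L` to at most `L * T`. -/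
theorem sum_mul_le_of_sum_eq_zero {α : Type*} [Fintype α] {d f : α → ℝ} {m L T : ℝ}
    (hL : 0 ≤ L) (hd : ∑ x, d x = 0) (hT : ∀ B : Finset α, ∑ x ∈ B, d x ≤ T)
    (hm : ∀ x, m ≤ f x) (hM : ∀ x, f x ≤ m + L) : ∑ x, d x * f x ≤ L * T := by
  classical
  calc ∑ x, d x * f x = ∑ x, d x * (f x - m) := by
        simp [mul_sub, sum_sub_distrib, ← sum_mul, hd]
    _ ≤ ∑ x, if 0 < d x then L * d x else 0 := by
        refine sum_le_sum fun x _ => ?_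
        have h1 := hm x
        have h2 := hM x
        split_ifs with h
        · nlinarith
        · nlinarith
    _ = L * ∑ x with 0 < d x, d x := by rw [← sum_filter, mul_sum]
    _ ≤ L * T := mul_le_mul_of_nonneg_left (hT _) hL

theorem abs_sum_mul_le_of_sum_eq_zero {α : Type*} [Fintype α] {d f : α → ℝ} {m L T : ℝ}
    (hL : 0 ≤ L) (hd : ∑ x, d x = 0) (hT : ∀ B : Finset α, |∑ x ∈ B, d x| ≤ T)
    (hm : ∀ x, m ≤ f x) (hM : ∀ x, f x ≤ m + L) : |∑ x, d x * f x| ≤ L * T := by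
  refine abs_le'.2 ⟨sum_mul_le_of_sum_eq_zero hL hd (fun B => (abs_le'.1 (hT B)).1) hm hM, ?_⟩
  have h := sum_mul_le_of_sum_eq_zero (d := fun x => -d x) hL (by simp [hd])
    (fun B => by simpa using (abs_le'.1 (hT B)).2) hm hM
  simpa using h

/-- For the Little model with parameters `θ = (w, b)`, the
transition kernel `P_θ` is a contraction for the total variation distance
`d_TV(μ₁,μ₂) = ⨆ B ⊆ X, |μ₁(B) − μ₂(B)|` with coefficient
`1 − σ(−‖w‖_∞ − ‖b‖_∞)^n`: for any two probability measures `μ₁, μ₂` on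
`{0,1}^n`, `d_TV(μ₁P_θ, μ₂P_θ) ≤ (1 − σ(−‖w‖_∞ − ‖b‖_∞)^n) d_TV(μ₁, μ₂)`,
where `‖w‖_∞ = max_i ∑ j |w i j|` and `‖b‖_∞ = max_i |b i|`, and
`(μP)(y) = ∑ x, μ(x) P(x,y)`. -/
theorem littleKernel_tv_contraction {n : ℕ}
    (w : Fin n → Fin n → ℝ) (b : Fin n → ℝ)
    (μ₁ μ₂ : (Fin n → Fin 2) → ℝ)
    (hμ₁0 : ∀ x, 0 ≤ μ₁ x) (hμ₁1 : ∑ x, μ₁ x = 1)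
    (hμ₂0 : ∀ x, 0 ≤ μ₂ x) (hμ₂1 : ∑ x, μ₂ x = 1) :
    (⨆ B : Finset (Fin n → Fin 2),
        |(∑ y ∈ B, ∑ x, μ₁ x * littleKernel w b x y) -
          ∑ y ∈ B, ∑ x, μ₂ x * littleKernel w b x y|)
      ≤ (1 - logistic (-(⨆ i : Fin n, ∑ j, |w i j|) - ⨆ i : Fin n, |b i|) ^ n) *
          ⨆ B : Finset (Fin n → Fin 2), |(∑ x ∈ B, μ₁ x) - ∑ x ∈ B, μ₂ x| := by
  set ε := logistic (-(⨆ i : Fin n, ∑ j, |w i j|) - ⨆ i : Fin n, |b i|) ^ n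
  have hε : ∀ x y, ε ≤ littleKernel w b x y := logistic_pow_le_littleKernel w b
  have hle : ∀ x (B : Finset (Fin n → Fin 2)), ∑ y ∈ B, littleKernel w b x y ≤ 1 := fun x B =>
    (sum_le_sum_of_subset_of_nonneg (subset_univ B)
      fun y _ _ => littleKernel_nonneg w b x y).trans_eq (sum_littleKernel w b x)
  have hL : 0 ≤ 1 - ε := by
    have h := (hε 0 0).trans (by simpa using hle 0 {0})
    linarith
  refine ciSup_le fun B => ?_
  have hrw : (∑ y ∈ B, ∑ x, μ₁ x * littleKernel w b x y) -
      ∑ y ∈ B, ∑ x, μ₂ x * littleKernel w b x y =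
      ∑ x, (μ₁ x - μ₂ x) * ∑ y ∈ B, littleKernel w b x y := by
    rw [sum_comm, sum_comm (s := B), ← sum_sub_distrib]
    exact sum_congr rfl fun x _ => by rw [← mul_sum, ← mul_sum, sub_mul]
  have hd : ∑ x, (μ₁ x - μ₂ x) = 0 := by rw [sum_sub_distrib, hμ₁1, hμ₂1, sub_self]
  have hT : ∀ A : Finset (Fin n → Fin 2), |∑ x ∈ A, (μ₁ x - μ₂ x)| ≤
      ⨆ B : Finset (Fin n → Fin 2), |(∑ x ∈ B, μ₁ x) - ∑ x ∈ B, μ₂ x| := fun A => by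
    rw [sum_sub_distrib]
    exact le_ciSup (f := fun B : Finset (Fin n → Fin 2) => |(∑ x ∈ B, μ₁ x) - ∑ x ∈ B, μ₂ x|)
      (Set.finite_range _).bddAbove A
  rw [hrw]
  rcases B.eq_empty_or_nonempty with rfl | ⟨y, hy⟩
  · exact abs_sum_mul_le_of_sum_eq_zero (m := 0) hL hd hT (by simp) (by simpa using hL)
  · refine abs_sum_mul_le_of_sum_eq_zero (m := ε) hL hd hT (fun x => ?_) fun x => ?_
    · exact (hε x y).trans
        (single_le_sum (f := littleKernel w b x) (fun z _ => littleKernel_nonneg w b x z) hy)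
    · simpa using hle x B
end

section
/- For the Little model, fix x⁰ ∈ {0,1}^n, parameters θ = (w,b), a nonzero direction v ∈ ℝ^{n×n} × ℝ^n, and a cost function e : {0,1}^n → ℝ. Define c_{θ,v}(x⁰) = Σ_{i=1}^n |v_i| σ(u_i(x⁰,θ)) + Σ_{i=1}^n Σ_{j=1}^n |v_{i,j}| x⁰_j σ(u_i(x⁰,θ)), and define P⁺_{θ,v}(x⁰,x¹) = (P_θ(x⁰,x¹)/c_{θ,v}(x⁰))·Σ_{i=1}^n [ x¹_i((v_i)_+ + Σ_j (v_{i,j})_+ x⁰_j) + σ(u_i(x⁰,θ))((v_i)_− + Σ_j (v_{i,j})_− x⁰_j) ] and P⁻_{θ,v}(x⁰,x¹) = (P_θ(x⁰,x¹)/c_{θ,v}(x⁰))·Σ_{i=1}^n [ x¹_i((v_i)_− + Σ_j (v_{i,j})_− x⁰_j) + σ(u_i(x⁰,θ))((v_i)_+ + Σ_j (v_{i,j})_+ x⁰_j) ]. Assume c_{θ,v}(x⁰) > 0. Then the derivative at λ = 0 of λ ↦ Σ_{x¹∈{0,1}^n} e(x¹) P_{θ+λv}(x⁰,x¹) equals c_{θ,v}(x⁰)·[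 Σ_{x¹} e(x¹) P⁺_{θ,v}(x⁰,x¹) − Σ_{x¹} e(x¹) P⁻_{θ,v}(x⁰,x¹) ]. -/
open Finset

/-- The normalizing constant
`c_{θ,v}(x⁰) = ∑ i, |v_i| σ(u_i(x⁰,θ)) + ∑ i, ∑ j, |v_{i,j}| x⁰_j σ(u_i(x⁰,θ))`. -/
noncomputable def cLittle {n : ℕ} (w : Fin n → Fin n → ℝ) (b : Fin n → ℝ)
    (vw : Fin n → Fin n → ℝ) (vb : Fin n → ℝ) (x0 : Fin n → Fin 2) : ℝ :=
  ∑ i, |vb i| * logistic (nodeInput w b x0 i) +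
    ∑ i, ∑ j, |vw i j| * ((x0 j : ℕ) : ℝ) * logistic (nodeInput w b x0 i)

/-- The "positive" kernel `P⁺_{θ,v}(x⁰,x¹)` of the measure-valued directional
derivative of the Little model. -/
noncomputable def PplusLittle {n : ℕ} (w : Fin n → Fin n → ℝ) (b : Fin n → ℝ)
    (vw : Fin n → Fin n → ℝ) (vb : Fin n → ℝ) (x0 x1 : Fin n → Fin 2) : ℝ :=
  (littleKernel w b x0 x1 / cLittle w b vw vb x0) *
    ∑ i, (((x1 i : ℕ) : ℝ) * (max 0 (vb i) + ∑ j, max 0 (vw i j) * ((x0 j : ℕ) : ℝ)) +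
      logistic (nodeInput w b x0 i) *
        (max 0 (-(vb i)) + ∑ j, max 0 (-(vw i j)) * ((x0 j : ℕ) : ℝ)))

/-- The "negative" kernel `P⁻_{θ,v}(x⁰,x¹)` of the measure-valued directional
derivative of the Little model. -/
noncomputable def PminusLittle {n : ℕ} (w : Fin n → Fin n → ℝ) (b : Fin n → ℝ)
    (vw : Fin n → Fin n → ℝ) (vb : Fin n → ℝ) (x0 x1 : Fin n → Fin 2) : ℝ :=
  (littleKernel w b x0 x1 / cLittle w b vw vb x0) *
    ∑ i, (((x1 i : ℕ) : ℝ) * (max 0 (-(vb i)) + ∑ j, max 0 (-(vw i j)) * ((x0 j : ℕ) : ℝ)) +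
      logistic (nodeInput w b x0 i) *
        (max 0 (vb i) + ∑ j, max 0 (vw i j) * ((x0 j : ℕ) : ℝ)))

theorem hasDerivAt_logistic (x : ℝ) :
    HasDerivAt logistic (logistic x * (1 - logistic x)) x := by
  have h : logistic = Real.sigmoid := by
    funext y
    simp [logistic, Real.sigmoid_def]
  rw [h]
  exact Real.hasDerivAt_sigmoid x

theorem nodeInput_add_mul {n : ℕ} (w : Fin n → Fin n → ℝ) (b : Fin n → ℝ)
    (vw : Fin n → Fin n → ℝ) (vb : Fin n → ℝ) (x : Fin n → Fin 2) (i : Fin n) (t : ℝ) :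
    nodeInput (fun i j => w i j + t * vw i j) (fun i => b i + t * vb i) x i =
      nodeInput w b x i + t * nodeInput vw vb x i := by
  simp only [nodeInput, add_mul, Finset.sum_add_distrib, mul_add, Finset.mul_sum, mul_assoc]
  ring

theorem hasDerivAt_bernoulli_logistic {u d : ℝ} (k : Fin 2) :
    HasDerivAt
      (fun t : ℝ => logistic (u + t * d) ^ (k : ℕ) * (1 - logistic (u + t * d)) ^ (1 - (k : ℕ)))
      (logistic u ^ (k : ℕ) * (1 - logistic u) ^ (1 - (k : ℕ)) *
        ((((k : ℕ) : ℝ) - logistic u) * d)) 0 := by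
  have hlin : HasDerivAt (fun t : ℝ => u + t * d) d 0 := by
    simpa using ((hasDerivAt_id (0 : ℝ)).mul_const d).const_add u
  have hσ : HasDerivAt (fun t : ℝ => logistic (u + t * d))
      (logistic u * (1 - logistic u) * d) 0 := by
    have h := (hasDerivAt_logistic (u + 0 * d)).comp (0 : ℝ) hlin
    rwa [zero_mul, add_zero] at h
  obtain rfl | rfl : k = 0 ∨ k = 1 := by lia
  · convert! hσ.const_sub 1 using 1
    · simp
    · simp
      ring
  · convert! hσ using 1
    · simp
    · simp
      ring

/-- The directional derivative of the kernel, in terms of its score. -/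
theorem hasDerivAt_littleKernel {n : ℕ} (w : Fin n → Fin n → ℝ) (b : Fin n → ℝ)
    (vw : Fin n → Fin n → ℝ) (vb : Fin n → ℝ) (x0 x1 : Fin n → Fin 2) :
    HasDerivAt
      (fun t : ℝ =>
        littleKernel (fun i j => w i j + t * vw i j) (fun i => b i + t * vb i) x0 x1)
      (littleKernel w b x0 x1 *
        ∑ i, (((x1 i : ℕ) : ℝ) - logistic (nodeInput w b x0 i)) * nodeInput vw vb x0 i) 0 := by
  simp only [littleKernel, nodeInput_add_mul]
  convert! HasDerivAt.fun_finsetProd (u := Finset.univ) fun i _ =>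
    hasDerivAt_bernoulli_logistic (u := nodeInput w b x0 i) (d := nodeInput vw vb x0 i) (x1 i)
    using 1
  rw [Finset.mul_sum]
  refine Finset.sum_congr rfl fun i hi => ?_
  simp only [zero_mul, add_zero, smul_eq_mul]
  rw [← Finset.prod_erase_mul _ _ hi, mul_assoc]

theorem nodeInput_eq_posPart_sub_negPart {n : ℕ} (vw : Fin n → Fin n → ℝ) (vb : Fin n → ℝ)
    (x : Fin n → Fin 2) (i : Fin n) :
    nodeInput vw vb x i =
      (max 0 (vb i) + ∑ j, max 0 (vw i j) * ((x j : ℕ) : ℝ)) -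
        (max 0 (-(vb i)) + ∑ j, max 0 (-(vw i j)) * ((x j : ℕ) : ℝ)) := by
  have h (a : ℝ) : a = max 0 a - max 0 (-a) := by
    rw [max_comm 0 a, max_comm 0 (-a), max_zero_sub_max_neg_zero_eq_self]
  rw [add_sub_add_comm, ← h, ← Finset.sum_sub_distrib]
  simp only [← sub_mul, ← h]
  exact add_comm _ _

theorem cLittle_mul_PplusLittle_sub_PminusLittle {n : ℕ} (w : Fin n → Fin n → ℝ)
    (b : Fin n → ℝ) (vw : Fin n → Fin n → ℝ) (vb : Fin n → ℝ) (x0 x1 : Fin n → Fin 2)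
    (hc : cLittle w b vw vb x0 ≠ 0) :
    cLittle w b vw vb x0 * (PplusLittle w b vw vb x0 x1 - PminusLittle w b vw vb x0 x1) =
      littleKernel w b x0 x1 *
        ∑ i, (((x1 i : ℕ) : ℝ) - logistic (nodeInput w b x0 i)) * nodeInput vw vb x0 i := by
  rw [PplusLittle, PminusLittle, ← mul_sub, ← mul_assoc, mul_div_cancel₀ _ hc,
    ← Finset.sum_sub_distrib]
  congr 1
  refine Finset.sum_congr rfl fun i _ => ?_
  rw [nodeInput_eq_posPart_sub_negPart vw vb]
  ring

/-- For the Little model, fix `x⁰`, parameters `θ = (w,b)`, a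
nonzero direction `v = (vw, vb)` and a cost function `e`. Assume
`c_{θ,v}(x⁰) > 0`. Then the derivative at `λ = 0` of
`λ ↦ ∑ x¹, e(x¹) P_{θ+λv}(x⁰,x¹)` equals
`c_{θ,v}(x⁰)·[∑ x¹, e(x¹) P⁺_{θ,v}(x⁰,x¹) − ∑ x¹, e(x¹) P⁻_{θ,v}(x⁰,x¹)]`. -/
theorem littleKernel_directional_mvd {n : ℕ}
    (w : Fin n → Fin n → ℝ) (b : Fin n → ℝ)
    (vw : Fin n → Fin n → ℝ) (vb : Fin n → ℝ)
    (hv : ¬(vw = 0 ∧ vb = 0))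
    (x0 : Fin n → Fin 2)
    (hc : 0 < cLittle w b vw vb x0)
    (e : (Fin n → Fin 2) → ℝ) :
    HasDerivAt
      (fun lam : ℝ => ∑ x1, e x1 *
        littleKernel (fun i j => w i j + lam * vw i j) (fun i => b i + lam * vb i) x0 x1)
      (cLittle w b vw vb x0 *
        ((∑ x1, e x1 * PplusLittle w b vw vb x0 x1) -
          ∑ x1, e x1 * PminusLittle w b vw vb x0 x1))
      0 := by
  convert! HasDerivAt.fun_sum fun x1 (_ : x1 ∈ Finset.univ) =>
    (hasDerivAt_littleKernel w b vw vb x0 x1).const_mul (e x1) using 1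
  rw [← Finset.sum_sub_distrib, Finset.mul_sum]
  refine Finset.sum_congr rfl fun x1 _ => ?_
  rw [← cLittle_mul_PplusLittle_sub_PminusLittle w b vw vb x0 x1 hc.ne']
  ring
end

section
/- Let n ≥ 1, c > 0, d ∈ ℝ, a_1,…,a_n ∈ ℝ, β_1,…,β_n ∈ ℝ, and define Q(x) = (1/c)·(d + Σ_{i=1}^n a_i x_i)·Π_{i=1}^n β_i^{x_i}(1−β_i)^{1−x_i} for x ∈ {0,1}^n. Then for every 1 ≤ k ≤ n and every (x_1,…,x_k) ∈ {0,1}^k, the partial marginal satisfies Σ_{x_{k+1}∈{0,1}} ⋯ Σ_{x_n∈{0,1}} Q(x_1,…,x_n) = (1/c)·( d + Σ_{i=1}^k a_i x_i + Σ_{i=k+1}^n a_i β_i )·Π_{i=1}^k β_i^{x_i}(1−β_i)^{1−x_i}. -/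
open Finset

/-- If `m i` is the mean of `f i` on `S i` with respect to the (unnormalized) weight `w i`, then
the mean of the additive function `x ↦ d + ∑ i, f i (x i)` with respect to the product weight is
`d + ∑ i, m i`. -/
theorem sum_piFinset_add_sum_mul_prod {ι R : Type*} {α : ι → Type*} [Fintype ι] [DecidableEq ι]
    [CommSemiring R] (S : ∀ i, Finset (α i)) (f w : ∀ i, α i → R) (d : R) (m : ι → R)
    (h : ∀ i, ∑ v ∈ S i, f i v * w i v = m i * ∑ v ∈ S i, w i v) :
    ∑ x ∈ Fintype.piFinset S, (d + ∑ i, f i (x i)) * ∏ i, w i (x i)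
      = (d + ∑ i, m i) * ∏ i, ∑ v ∈ S i, w i v := by
  have key : ∀ j, ∑ x ∈ Fintype.piFinset S, f j (x j) * ∏ i, w i (x i)
      = m j * ∏ i, ∑ v ∈ S i, w i v := by
    intro j
    have split : ∀ x : ∀ i, α i, f j (x j) * ∏ i, w i (x i)
        = ∏ i, (if i = j then f i (x i) else 1) * w i (x i) := fun x => by
      rw [Finset.prod_mul_distrib, Finset.prod_ite_eq' univ j (fun i => f i (x i)),
        if_pos (mem_univ j)]
    rw [Finset.sum_congr rfl fun x _ => split x,
      ← Finset.prod_univ_sum S fun i v => (if i = j then f i v else 1) * w i v]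
    have factor : ∀ i, ∑ v ∈ S i, (if i = j then f i v else 1) * w i v
        = (if i = j then m i else 1) * ∑ v ∈ S i, w i v := fun i => by
      split_ifs <;> simp [h]
    simp_rw [factor, Finset.prod_mul_distrib]
    simp
  simp_rw [add_mul, Finset.sum_mul, Finset.sum_add_distrib]
  rw [Finset.sum_comm, ← Finset.mul_sum, Finset.prod_univ_sum]
  simp_rw [key, Finset.prod_univ_sum]

/-- Let `n ≥ 1`, `c > 0`, `d ∈ ℝ`, `a, β : Fin n → ℝ`, and
`Q(x) = (1/c)·(d + ∑ i, a_i x_i)·∏ i, β_i^{x_i}(1−β_i)^{1−x_i}` on `{0,1}^n`.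
Then for every `1 ≤ k ≤ n` and fixed values of the first `k` coordinates
(given by `xs`), the partial marginal obtained by summing out `x_{k+1},…,x_n`
satisfies
`∑_{x_{k+1},…,x_n} Q(x) = (1/c)·(d + ∑_{i≤k} a_i x_i + ∑_{i>k} a_i β_i)·
   ∏_{i≤k} β_i^{x_i}(1−β_i)^{1−x_i}`.
Here coordinates `x_1,…,x_k` correspond to indices `i : Fin n` with `(i:ℕ) < k`,
and the marginal is the sum over all `x ∈ {0,1}^n` agreeing with `xs` on
those indices. -/
theorem bernoulli_affine_partial_marginal {n : ℕ} (hn : 1 ≤ n)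
    (c : ℝ) (hc : 0 < c) (d : ℝ) (a β : Fin n → ℝ)
    (k : ℕ) (hk1 : 1 ≤ k) (hkn : k ≤ n)
    (xs : Fin n → Fin 2) :
    ∑ x ∈ Finset.univ.filter
        (fun x : Fin n → Fin 2 => ∀ i : Fin n, (i : ℕ) < k → x i = xs i),
        (1 / c) * (d + ∑ i, a i * ((x i : ℕ) : ℝ)) *
          ∏ i, β i ^ ((x i : ℕ)) * (1 - β i) ^ (1 - (x i : ℕ))
      = (1 / c) *
          (d + (∑ i ∈ Finset.univ.filter (fun i : Fin n => (i : ℕ) < k),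
              a i * ((xs i : ℕ) : ℝ)) +
            ∑ i ∈ Finset.univ.filter (fun i : Fin n => k ≤ (i : ℕ)), a i * β i) *
          ∏ i ∈ Finset.univ.filter (fun i : Fin n => (i : ℕ) < k),
            β i ^ ((xs i : ℕ)) * (1 - β i) ^ (1 - (xs i : ℕ)) := by
  set S : Fin n → Finset (Fin 2) := fun i => if (i : ℕ) < k then {xs i} else univ with hS
  set w : Fin n → Fin 2 → ℝ := fun i v => β i ^ (v : ℕ) * (1 - β i) ^ (1 - (v : ℕ)) with hw
  set m : Fin n → ℝ := fun i => if (i : ℕ) < k then a i * ((xs i : ℕ) : ℝ) else a i * β i with hm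
  have fiber : univ.filter (fun x : Fin n → Fin 2 => ∀ i : Fin n, (i : ℕ) < k → x i = xs i)
      = Fintype.piFinset S := by
    ext x
    simp only [mem_filter, mem_univ, true_and, Fintype.mem_piFinset, hS]
    refine forall_congr' fun i => ?_
    split_ifs with hi <;> simp [hi]
  have weight : ∀ i, ∑ v ∈ S i, w i v = if (i : ℕ) < k then w i (xs i) else 1 := fun i => by
    by_cases hi : (i : ℕ) < k <;> simp [hS, hw, hi]
  have mean : ∀ i, ∑ v ∈ S i, a i * ((v : ℕ) : ℝ) * w i v = m i * ∑ v ∈ S i, w i v := fun i => by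
    by_cases hi : (i : ℕ) < k <;> simp [hS, hw, hm, hi]
  have total : ∑ i, m i = (∑ i ∈ univ.filter (fun i : Fin n => (i : ℕ) < k),
      a i * ((xs i : ℕ) : ℝ)) + ∑ i ∈ univ.filter (fun i : Fin n => k ≤ (i : ℕ)), a i * β i := by
    simp only [hm, Finset.sum_ite, not_lt]
  have marginal := sum_piFinset_add_sum_mul_prod S (fun i v => a i * ((v : ℕ) : ℝ)) w d m mean
  simp_rw [weight, total, ← Finset.prod_filter, ← add_assoc] at marginal
  rw [fiber, mul_assoc, ← marginal, Finset.mul_sum]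
  simp only [mul_assoc, hw]
end

section
/- Let n ≥ 1, d ≥ 0, a_1,…,a_n ≥ 0, β_1,…,β_n ∈ (0,1) with d + Σ_{i=1}^n β_i a_i > 0, let c = d + Σ_{i=1}^n β_i a_i, and define the probability Q(x) = (1/c)·(d + Σ_{i=1}^n a_i x_i)·Π_{i=1}^n β_i^{x_i}(1−β_i)^{1−x_i} on {0,1}^n. Then for every 2 ≤ k ≤ n and every (x_1,…,x_{k−1}) ∈ {0,1}^{k−1} with Q(x_1,…,x_{k−1}) > 0, the conditional probability satisfies Q(x_k = 1 | x_{k−1},…,x_1) = β_k·( d + Σ_{i=1}^{k−1} a_i x_i + a_k + Σ_{i=k+1}^n β_i a_i ) / ( d + Σ_{i=1}^{k−1} a_i x_i + Σ_{i=k}^n β_i a_i ), where the conditional probability is the ratio of the partial marginals Q(x_1,…,x_{k−1},1)/Q(x_1,…,x_{k−1}) of Q. -/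
open Finset

/-- Against a product weight on a product of finsets, a sum of functions of single coordinates
integrates to the total mass times the sum of the coordinate means. -/
theorem sum_piFinset_affine_mul_prod {ι κ : Type*} [Fintype ι] [DecidableEq ι]
    (t : ι → Finset κ) (d : ℝ) (f w : ι → κ → ℝ) (m μ : ι → ℝ)
    (hm : ∀ i, ∑ y ∈ t i, w i y = m i)
    (hμ : ∀ i, ∑ y ∈ t i, f i y * w i y = m i * μ i) :
    ∑ x ∈ Fintype.piFinset t, (d + ∑ i, f i (x i)) * ∏ i, w i (x i)
      = (∏ i, m i) * (d + ∑ i, μ i) := by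
  have hcoord (i : ι) :
      ∑ x ∈ Fintype.piFinset t, f i (x i) * ∏ j, w j (x j) = (∏ j, m j) * μ i := by
    calc
      _ = ∑ x ∈ Fintype.piFinset t, ∏ j, (if j = i then f j (x j) else 1) * w j (x j) := by
        refine Finset.sum_congr rfl fun x _ => ?_
        rw [Finset.prod_mul_distrib, Finset.prod_ite_eq' Finset.univ i, if_pos (Finset.mem_univ i)]
      _ = ∏ j, ∑ y ∈ t j, (if j = i then f j y else 1) * w j y :=
        (Finset.prod_univ_sum t fun j y => (if j = i then f j y else 1) * w j y).symm
      _ = ∏ j, m j * (if j = i then μ j else 1) := by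
        refine Finset.prod_congr rfl fun j _ => ?_
        split_ifs
        · exact hμ j
        · simpa using hm j
      _ = _ := by
        rw [Finset.prod_mul_distrib, Finset.prod_ite_eq' Finset.univ i, if_pos (Finset.mem_univ i)]
  simp_rw [add_mul, Finset.sum_add_distrib, Finset.sum_mul]
  rw [Finset.sum_comm, ← Finset.mul_sum, ← Finset.prod_univ_sum]
  simp_rw [hcoord, hm, ← Finset.mul_sum]
  ring

/-- The total mass and the mean of a tilted Bernoulli product weight over the cylinder of points
that agree with `xs` on the coordinates below `j`. -/
theorem sum_cylinder_affine_mul_bernoulli {n : ℕ} (d : ℝ) (a β : Fin n → ℝ) (j : ℕ)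
    (xs : Fin n → Fin 2) :
    ∑ x ∈ Finset.univ.filter
        (fun x : Fin n → Fin 2 => ∀ i : Fin n, (i : ℕ) < j → x i = xs i),
      (d + ∑ i, a i * ((x i : ℕ) : ℝ)) *
        ∏ i, β i ^ (x i : ℕ) * (1 - β i) ^ (1 - (x i : ℕ))
      = (∏ i : Fin n, if (i : ℕ) < j then β i ^ (xs i : ℕ) * (1 - β i) ^ (1 - (xs i : ℕ)) else 1) *
        (d + ∑ i : Fin n, if (i : ℕ) < j then a i * ((xs i : ℕ) : ℝ) else β i * a i) := by
  have hcyl : Finset.univ.filter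
        (fun x : Fin n → Fin 2 => ∀ i : Fin n, (i : ℕ) < j → x i = xs i)
      = Fintype.piFinset fun i : Fin n => if (i : ℕ) < j then {xs i} else Finset.univ := by
    ext x
    simp only [Finset.mem_filter, Finset.mem_univ, true_and, Fintype.mem_piFinset]
    refine forall_congr' fun i => ?_
    split_ifs with h <;> simp [h]
  rw [hcyl]
  refine sum_piFinset_affine_mul_prod _ d (fun i (y : Fin 2) => a i * ((y : ℕ) : ℝ))
    (fun i (y : Fin 2) => β i ^ (y : ℕ) * (1 - β i) ^ (1 - (y : ℕ))) _ _ (fun i => ?_) fun i => ?_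
  · split_ifs <;> simp [Fin.sum_univ_two]
  · split_ifs
    · simp [mul_comm]
    · simp [Fin.sum_univ_two, mul_comm]

/-- Let `n ≥ 1`, `d ≥ 0`, `a_i ≥ 0`, `β_i ∈ (0,1)` with
`c := d + ∑ i, β_i a_i > 0`, and let
`Q(x) = (1/c)·(d + ∑ i, a_i x_i)·∏ i, β_i^{x_i}(1−β_i)^{1−x_i}` on `{0,1}^n`.
For `j ≤ n`, the partial marginal `M j xs` is the sum of `Q` over all
`x ∈ {0,1}^n` agreeing with `xs` on the indices `i` with `(i:ℕ) < j`
(coordinates `x_1,…,x_j`). Then for every `2 ≤ k ≤ n` and every choice `xs` of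
the first `k−1` coordinates with `Q(x_1,…,x_{k−1}) = M (k−1) xs > 0`, the
conditional probability `Q(x_k = 1 ∣ x_{k−1},…,x_1)`, i.e. the ratio of partial
marginals `Q(x_1,…,x_{k−1},1)/Q(x_1,…,x_{k−1})`, equals
`β_k·(d + ∑_{i<k} a_i x_i + a_k + ∑_{i>k} β_i a_i) /
   (d + ∑_{i<k} a_i x_i + ∑_{i≥k} β_i a_i)`. -/
theorem bernoulli_affine_conditional {n : ℕ}
    (d : ℝ) (a β : Fin n → ℝ)
    (hd : 0 ≤ d) (ha : ∀ i, 0 ≤ a i) (hβ : ∀ i, β i ∈ Set.Ioo (0 : ℝ) 1)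
    (hpos : 0 < d + ∑ i, β i * a i)
    (k : ℕ) (hk2 : 2 ≤ k) (hkn : k ≤ n)
    (xs : Fin n → Fin 2) :
    let c : ℝ := d + ∑ i, β i * a i
    let Q : (Fin n → Fin 2) → ℝ := fun x =>
      (1 / c) * (d + ∑ i, a i * ((x i : ℕ) : ℝ)) *
        ∏ i, β i ^ ((x i : ℕ)) * (1 - β i) ^ (1 - (x i : ℕ))
    let M : ℕ → (Fin n → Fin 2) → ℝ := fun j xs' =>
      ∑ x ∈ Finset.univ.filter
          (fun x : Fin n → Fin 2 => ∀ i : Fin n, (i : ℕ) < j → x i = xs' i), Q x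
    let kk : Fin n := ⟨k - 1, by omega⟩
    0 < M (k - 1) xs →
      M k (Function.update xs kk 1) / M (k - 1) xs
        = β kk *
            (d + (∑ i ∈ Finset.univ.filter (fun i : Fin n => (i : ℕ) < k - 1),
                a i * ((xs i : ℕ) : ℝ)) + a kk +
              ∑ i ∈ Finset.univ.filter (fun i : Fin n => k ≤ (i : ℕ)), β i * a i) /
          (d + (∑ i ∈ Finset.univ.filter (fun i : Fin n => (i : ℕ) < k - 1),
              a i * ((xs i : ℕ) : ℝ)) +
            ∑ i ∈ Finset.univ.filter (fun i : Fin n => k - 1 ≤ (i : ℕ)), β i * a i) := by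
  intro c Q M kk hM
  have hkk : (kk : ℕ) = k - 1 := rfl
  have hmarginal (j : ℕ) (ys : Fin n → Fin 2) : M j ys = (1 / c) *
      ((∏ i : Fin n, if (i : ℕ) < j then β i ^ (ys i : ℕ) * (1 - β i) ^ (1 - (ys i : ℕ)) else 1) *
        (d + ∑ i : Fin n, if (i : ℕ) < j then a i * ((ys i : ℕ) : ℝ) else β i * a i)) := by
    rw [← sum_cylinder_affine_mul_bernoulli, Finset.mul_sum]
    exact Finset.sum_congr rfl fun x _ => mul_assoc _ _ _
  have hprod : (∏ i : Fin n, if (i : ℕ) < k then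
        β i ^ (Function.update xs kk 1 i : ℕ) * (1 - β i) ^ (1 - (Function.update xs kk 1 i : ℕ))
        else 1)
      = β kk * ∏ i : Fin n, if (i : ℕ) < k - 1 then
        β i ^ (xs i : ℕ) * (1 - β i) ^ (1 - (xs i : ℕ)) else 1 := by
    have hβkk : β kk = ∏ i, if i = kk then β i else 1 := by simp
    rw [hβkk, ← Finset.prod_mul_distrib]
    refine Finset.prod_congr rfl fun i _ => ?_
    by_cases hi : i = kk
    · have h₁ : (i : ℕ) < k := by rw [hi]; omega
      have h₂ : ¬ (i : ℕ) < k - 1 := by rw [hi]; omega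
      rw [if_pos h₁, if_neg h₂, if_pos hi, hi]
      simp
    · have hne : (i : ℕ) ≠ k - 1 := fun h => hi (Fin.ext h)
      have hiff : (i : ℕ) < k ↔ (i : ℕ) < k - 1 := by omega
      simp [hi, hiff]
  have hnum : (∑ i : Fin n, if (i : ℕ) < k then
        a i * ((Function.update xs kk 1 i : ℕ) : ℝ) else β i * a i)
      = (∑ i ∈ Finset.univ.filter (fun i : Fin n => (i : ℕ) < k - 1), a i * ((xs i : ℕ) : ℝ))
        + a kk + ∑ i ∈ Finset.univ.filter (fun i : Fin n => k ≤ (i : ℕ)), β i * a i := by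
    have hakk : a kk = ∑ i, if i = kk then a i else 0 := by simp
    rw [hakk, Finset.sum_filter, Finset.sum_filter, ← Finset.sum_add_distrib,
      ← Finset.sum_add_distrib]
    refine Finset.sum_congr rfl fun i _ => ?_
    by_cases hi : i = kk
    · have h₁ : (i : ℕ) < k := by rw [hi]; omega
      have h₂ : ¬ (i : ℕ) < k - 1 := by rw [hi]; omega
      have h₃ : ¬ k ≤ (i : ℕ) := by omega
      rw [if_pos h₁, if_neg h₂, if_neg h₃, if_pos hi, hi]
      simp
    · have hne : (i : ℕ) ≠ k - 1 := fun h => hi (Fin.ext h)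
      have hiff : (i : ℕ) < k ↔ (i : ℕ) < k - 1 := by omega
      have hle : k ≤ (i : ℕ) ↔ ¬ (i : ℕ) < k - 1 := by omega
      rw [Function.update_of_ne hi]
      by_cases h : (i : ℕ) < k - 1 <;> simp [hi, hiff, hle, h]
  have hden : (∑ i : Fin n, if (i : ℕ) < k - 1 then a i * ((xs i : ℕ) : ℝ) else β i * a i)
      = (∑ i ∈ Finset.univ.filter (fun i : Fin n => (i : ℕ) < k - 1), a i * ((xs i : ℕ) : ℝ))
        + ∑ i ∈ Finset.univ.filter (fun i : Fin n => k - 1 ≤ (i : ℕ)), β i * a i := by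
    rw [Finset.sum_ite]
    simp only [not_lt]
  rw [hmarginal] at hM
  rw [hmarginal, hmarginal, hprod, hnum, hden]
  rw [hden] at hM
  have hc : 1 / c ≠ 0 := left_ne_zero_of_mul hM.ne'
  have hP := left_ne_zero_of_mul (right_ne_zero_of_mul hM.ne')
  rw [mul_div_mul_left _ _ hc, mul_comm (β kk), mul_assoc, mul_div_mul_left _ _ hP]
  simp only [add_assoc]
end

section
/- Let X be a finite set and let (P_θ)_{θ∈ℝ} be a family of Markov kernels on X such that each entry θ ↦ P_θ(x,y) is differentiable and there is ε > 0 with P_θ(x,y) ≥ ε for all θ, x, y. Then for each θ there is a unique stationary probability measure π_θ (i.e., π_θ P_θ = π_θ), and for every cost function e : X → ℝ the map θ ↦ π_θ(e) = Σ_{x∈X} e(x)π_θ(x) is differentiable. -/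
open Finset

open scoped Matrix

/-- The matrix `1 - (K - ε J)`, with `J` the all-ones matrix. For a kernel `K` bounded below by `ε`
it is strictly diagonally dominant, and the stationary measures of `K` are the probability solutions
`π` of `π ᵥ* minorizedResolvent K ε = ε`. -/
def minorizedResolvent {X : Type*} [DecidableEq X] (K : X → X → ℝ) (ε : ℝ) : Matrix X X ℝ :=
  1 - Matrix.of fun x y => K x y - ε

theorem sum_sub_minorization {X : Type*} [Fintype X] {K : X → X → ℝ} {ε : ℝ}
    (hrow : ∀ x, ∑ y, K x y = 1) (x : X) :
    ∑ y, (K x y - ε) = 1 - Fintype.card X * ε := by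
  simp [Finset.sum_sub_distrib, hrow]

section Kernel

variable {X : Type*} [Fintype X] [DecidableEq X] {K : X → X → ℝ} {ε : ℝ}

theorem minorizedResolvent_det_ne_zero [Nonempty X] (hrow : ∀ x, ∑ y, K x y = 1) (hε : 0 < ε)
    (hlb : ∀ x y, ε ≤ K x y) : (minorizedResolvent K ε).det ≠ 0 := by
  apply det_ne_zero_of_sum_row_lt_diag
  intro k
  have hcard : (0 : ℝ) < Fintype.card X * ε := by
    have : (0 : ℝ) < Fintype.card X := by exact_mod_cast Fintype.card_pos
    positivity
  have hoff : ∑ j ∈ univ.erase k, ‖minorizedResolvent K ε k j‖ =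
      ∑ j ∈ univ.erase k, (K k j - ε) := by
    refine Finset.sum_congr rfl fun j hj => ?_
    have hkj : k ≠ j := (Finset.ne_of_mem_erase hj).symm
    simp only [minorizedResolvent, Matrix.sub_apply, Matrix.one_apply_ne hkj, Matrix.of_apply,
      zero_sub, norm_neg, Real.norm_eq_abs]
    exact abs_of_nonneg (sub_nonneg.2 (hlb k j))
  have hsum := Finset.add_sum_erase univ (fun j => K k j - ε) (Finset.mem_univ k)
  rw [sum_sub_minorization hrow] at hsum
  have hdiag : 1 - (K k k - ε) ≤ ‖minorizedResolvent K ε k k‖ := by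
    simp only [minorizedResolvent, Matrix.sub_apply, Matrix.one_apply_eq, Matrix.of_apply]
    exact Real.le_norm_self _
  rw [hoff]
  linarith

theorem vecMul_minorizedResolvent_apply (v : X → ℝ) (y : X) :
    (v ᵥ* minorizedResolvent K ε) y = v y - ∑ x, v x * (K x y - ε) := by
  rw [minorizedResolvent, Matrix.vecMul_sub, Matrix.vecMul_one]
  rfl

theorem vecMul_minorizedResolvent_of_stationary {v : X → ℝ} (hsum : ∑ x, v x = 1)
    (hv : ∀ y, ∑ x, v x * K x y = v y) : v ᵥ* minorizedResolvent K ε = fun _ => ε := by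
  ext y
  rw [vecMul_minorizedResolvent_apply]
  simp only [mul_sub, Finset.sum_sub_distrib, ← Finset.sum_mul, hv, hsum]
  ring

theorem sum_eq_one_of_vecMul_minorizedResolvent [Nonempty X] (hrow : ∀ x, ∑ y, K x y = 1)
    (hε : 0 < ε) {v : X → ℝ} (hv : v ᵥ* minorizedResolvent K ε = fun _ => ε) :
    ∑ x, v x = 1 := by
  have hy (y : X) : v y - ∑ x, v x * (K x y - ε) = ε := by
    rw [← vecMul_minorizedResolvent_apply, hv]
  have htotal : ∑ y, (v y - ∑ x, v x * (K x y - ε)) = Fintype.card X * ε := by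
    simp [hy]
  rw [Finset.sum_sub_distrib, Finset.sum_comm] at htotal
  simp only [← Finset.mul_sum, sum_sub_minorization hrow, ← Finset.sum_mul] at htotal
  have hcard : (Fintype.card X : ℝ) * ε ≠ 0 :=
    mul_ne_zero (by exact_mod_cast Fintype.card_ne_zero) hε.ne'
  apply mul_right_cancel₀ hcard
  linarith

theorem nonneg_of_vecMul_minorizedResolvent [Nonempty X] (hrow : ∀ x, ∑ y, K x y = 1)
    (hε : 0 < ε) (hlb : ∀ x y, ε ≤ K x y) {v : X → ℝ}
    (hv : v ᵥ* minorizedResolvent K ε = fun _ => ε) (y : X) : 0 ≤ v y := by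
  have hneg (y : X) : (v y)⁻ ≤ ∑ x, (v x)⁻ * (K x y - ε) := by
    have hy : v y - ∑ x, v x * (K x y - ε) = ε := by
      rw [← vecMul_minorizedResolvent_apply, hv]
    have hle : -∑ x, v x * (K x y - ε) ≤ ∑ x, (v x)⁻ * (K x y - ε) := by
      rw [← Finset.sum_neg_distrib]
      refine Finset.sum_le_sum fun x _ => ?_
      rw [← neg_mul]
      exact mul_le_mul_of_nonneg_right (neg_le_negPart _) (sub_nonneg.2 (hlb x y))
    have hnonneg : 0 ≤ ∑ x, (v x)⁻ * (K x y - ε) :=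
      Finset.sum_nonneg fun x _ => mul_nonneg (negPart_nonneg _) (sub_nonneg.2 (hlb x y))
    exact sup_le (by linarith) hnonneg
  have htotal := Finset.sum_le_sum fun y (_ : y ∈ univ) => hneg y
  rw [Finset.sum_comm] at htotal
  simp only [← Finset.mul_sum, sum_sub_minorization hrow, ← Finset.sum_mul] at htotal
  have hcard : (0 : ℝ) < Fintype.card X * ε := by
    have : (0 : ℝ) < Fintype.card X := by exact_mod_cast Fintype.card_pos
    positivity
  have hsum : ∑ x, (v x)⁻ ≤ 0 := by nlinarith
  have hle := Finset.single_le_sum (fun x _ => negPart_nonneg (v x)) (Finset.mem_univ y)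
  have := neg_le_negPart (v y)
  linarith

theorem stationary_of_vecMul_minorizedResolvent {v : X → ℝ} (hsum : ∑ x, v x = 1)
    (hv : v ᵥ* minorizedResolvent K ε = fun _ => ε) (y : X) : ∑ x, v x * K x y = v y := by
  have hy : v y - ∑ x, v x * (K x y - ε) = ε := by
    rw [← vecMul_minorizedResolvent_apply, hv]
  simp only [mul_sub, Finset.sum_sub_distrib, ← Finset.sum_mul, hsum] at hy
  linarith

end Kernel

theorem Matrix.eq_inv_det_smul_vecMul_adjugate {n R : Type*} [Fintype n] [DecidableEq n] [Field R]
    {A : Matrix n n R} (hA : A.det ≠ 0) {v b : n → R} (h : v ᵥ* A = b) :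
    v = A.det⁻¹ • (b ᵥ* A.adjugate) := by
  rw [← h, Matrix.vecMul_vecMul, Matrix.mul_adjugate, Matrix.vecMul_smul, Matrix.vecMul_one,
    smul_smul, inv_mul_cancel₀ hA, one_smul]

theorem Matrix.differentiable_det {n : Type*} [Fintype n] [DecidableEq n] {A : ℝ → Matrix n n ℝ}
    (hA : ∀ i j, Differentiable ℝ fun t => A t i j) : Differentiable ℝ fun t => (A t).det := by
  simp only [Matrix.det_apply']
  fun_prop

theorem Matrix.differentiable_adjugate_apply {n : Type*} [Fintype n] [DecidableEq n]
    {A : ℝ → Matrix n n ℝ} (hA : ∀ i j, Differentiable ℝ fun t => A t i j) (i j : n) :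
    Differentiable ℝ fun t => (A t).adjugate i j := by
  simp only [Matrix.adjugate_apply]
  refine Matrix.differentiable_det fun k l => ?_
  by_cases hk : k = j
  · subst hk
    simp
  · simpa [Matrix.updateRow_ne hk] using hA k l

/-- Let `X` be a finite set and `(P_θ)_{θ∈ℝ}` a family of
Markov kernels on `X` such that each entry `θ ↦ P_θ(x,y)` is differentiable and
there is `ε > 0` with `P_θ(x,y) ≥ ε` for all `θ, x, y`. Then for each `θ` there
is a unique stationary probability measure `π_θ` (`π_θ P_θ = π_θ`), and for
every cost function `e : X → ℝ` the map `θ ↦ π_θ(e) = ∑ x, e(x) π_θ(x)` is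
differentiable. -/
theorem stationary_cost_differentiable
    {X : Type*} [Fintype X] [Nonempty X]
    (P : ℝ → X → X → ℝ)
    (hProw : ∀ θ x, ∑ y, P θ x y = 1)
    (hPdiff : ∀ x y, Differentiable ℝ fun θ => P θ x y)
    (ε : ℝ) (hε : 0 < ε) (hPlb : ∀ θ x y, ε ≤ P θ x y) :
    (∀ θ : ℝ, ∃! π : X → ℝ,
        (∀ x, 0 ≤ π x) ∧ (∑ x, π x = 1) ∧ ∀ y, ∑ x, π x * P θ x y = π y) ∧
      ∀ (π : ℝ → X → ℝ),
        (∀ θ, (∀ x, 0 ≤ π θ x) ∧ (∑ x, π θ x = 1) ∧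
          ∀ y, ∑ x, π θ x * P θ x y = π θ y) →
        ∀ e : X → ℝ, Differentiable ℝ fun θ => ∑ x, e x * π θ x := by
  classical
  have hdet (θ : ℝ) : (minorizedResolvent (P θ) ε).det ≠ 0 :=
    minorizedResolvent_det_ne_zero (hProw θ) hε (hPlb θ)
  refine ⟨fun θ => ?_, fun π hπ e => ?_⟩
  · obtain ⟨v, hv⟩ : ∃ v, v ᵥ* minorizedResolvent (P θ) ε = fun _ => ε := by
      refine ⟨(fun _ => ε) ᵥ* (minorizedResolvent (P θ) ε)⁻¹, ?_⟩
      rw [Matrix.vecMul_vecMul, Matrix.nonsing_inv_mul _ (hdet θ).isUnit, Matrix.vecMul_one]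
    have hsum := sum_eq_one_of_vecMul_minorizedResolvent (hProw θ) hε hv
    refine ⟨v, ⟨nonneg_of_vecMul_minorizedResolvent (hProw θ) hε (hPlb θ) hv, hsum,
      stationary_of_vecMul_minorizedResolvent hsum hv⟩, ?_⟩
    rintro w ⟨-, hwsum, hw⟩
    rw [Matrix.eq_inv_det_smul_vecMul_adjugate (hdet θ) hv,
      Matrix.eq_inv_det_smul_vecMul_adjugate (hdet θ)
        (vecMul_minorizedResolvent_of_stationary hwsum hw)]
  · have hentry (x y : X) : Differentiable ℝ fun θ => minorizedResolvent (P θ) ε x y := by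
      simp only [minorizedResolvent, Matrix.sub_apply, Matrix.of_apply]
      fun_prop
    have hformula (θ : ℝ) := Matrix.eq_inv_det_smul_vecMul_adjugate (hdet θ)
      (vecMul_minorizedResolvent_of_stationary (hπ θ).2.1 (hπ θ).2.2)
    have hπdiff (x : X) : Differentiable ℝ fun θ => π θ x := by
      have hx : (fun θ => π θ x) = fun θ => (minorizedResolvent (P θ) ε).det⁻¹ *
          ∑ y, ε * (minorizedResolvent (P θ) ε).adjugate y x := by
        funext θ
        rw [hformula θ]
        rfl
      rw [hx]
      have hadj (y : X) := Matrix.differentiable_adjugate_apply hentry y x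
      exact ((Matrix.differentiable_det hentry).inv hdet).mul (by fun_prop)
    fun_prop
end

section
/- Let X be a finite set and let (P_θ)_{θ∈ℝ} be a family of Markov kernels on X such that each entry θ ↦ P_θ(x,y) is differentiable and there is ε > 0 with P_θ(x,y) ≥ ε for all θ, x, y; let π_θ denote the unique stationary measure of P_θ. Fix θ, and suppose (c_θ, P⁺_θ, P⁻_θ) is a measure-valued derivative of P_θ at θ, i.e., c_θ : X → ℝ and P⁺_θ, P⁻_θ are Markov kernels on X such that for all x, y: (d/dθ)P_θ(x,y) = c_θ(x)·(P⁺_θ(x,y) − P⁻_θ(x,y)). Then for every cost function e : X → ℝ and every initial probability measure μ on X, the derivative of the stationary cost satisfies (d/dθ) π_θ(e) = lim_{M⁰→∞, M¹→∞} Σ_{x∈X} (μ P_θ^{M⁰})(x) · c_θ(x) · Σ_{t=1}^{M¹} [ Σ_{y} P⁺_θ(x,y)(P_θ^{t−1}e)(y) − Σ_{y} P⁻_θ(x,y)(P_θ^{t−1}e)(y) ], where (P^t e)(y) = Σ_z P^t(y,z)e(z). -/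
open Finset

/-- The `t`-step transition matrix `P^t` of a Markov kernel `P` on a finite
set: `P^0(x,y) = [x = y]` and `P^{t+1}(x,y) = ∑ z, P^t(x,z) P(z,y)`. -/
noncomputable def kernelPow {X : Type*} [Fintype X] [DecidableEq X]
    (P : X → X → ℝ) : ℕ → X → X → ℝ
  | 0 => fun x y => if x = y then 1 else 0
  | (t + 1) => fun x y => ∑ z, kernelPow P t x z * P z y

open Filter Topology Matrix

lemma kernelPow_eq_pow {X : Type*} [Fintype X] [DecidableEq X] (P : X → X → ℝ) (t : ℕ) (x y : X) :
    kernelPow P t x y = (Matrix.of P ^ t) x y := by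
  induction t generalizing y with
  | zero => simp [kernelPow, Matrix.one_apply]
  | succ t ih => simp [kernelPow, pow_succ, Matrix.mul_apply, ih]

section Doeblin

variable {X : Type*} [Fintype X]
  {M : Matrix X X ℝ} {p h : X → ℝ} {ε : ℝ}

/-- Doeblin contraction: a kernel with entries at least `ε` contracts functions centered under a
stationary measure by the factor `1 - ε`. -/
lemma norm_mulVec_le_of_le [Nonempty X] (hrow : M *ᵥ 1 = 1) (hε : 0 ≤ ε)
    (hlb : ∀ x y, ε ≤ M x y) (hp0 : ∀ x, 0 ≤ p x) (hp1 : p ⬝ᵥ 1 = 1) (hh : p ⬝ᵥ h = 0) :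
    ‖M *ᵥ h‖ ≤ (1 - ε) * ‖h‖ := by
  have hp_le (y : X) : p y ≤ 1 := by
    have h1 : ∑ x, p x = 1 := by simpa [dotProduct] using hp1
    exact h1 ▸ Finset.single_le_sum (fun i _ => hp0 i) (Finset.mem_univ y)
  have hQ (x y : X) : 0 ≤ M x y - ε * p y := by
    nlinarith [hlb x y, hp_le y]
  refine (pi_norm_le_iff_of_nonempty _).2 fun x => ?_
  have hMh : (M *ᵥ h) x = ∑ y, (M x y - ε * p y) * h y := by
    have h0 : ∑ y, ε * p y * h y = 0 := by
      simpa [dotProduct, Finset.mul_sum, mul_assoc] using congrArg (ε * ·) hh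
    simp [sub_mul, h0, mulVec, dotProduct]
  have hsum : ∑ y, (M x y - ε * p y) = 1 - ε := by
    have h1 : ∑ y, M x y = 1 := by simpa [mulVec, dotProduct] using congrFun hrow x
    have h2 : ∑ y, p y = 1 := by simpa [dotProduct] using hp1
    rw [Finset.sum_sub_distrib, ← Finset.mul_sum, h1, h2, mul_one]
  rw [hMh, ← hsum, Finset.sum_mul]
  refine norm_sum_le_of_le _ fun y _ => ?_
  rw [norm_mul, Real.norm_of_nonneg (hQ x y)]
  exact mul_le_mul_of_nonneg_left (norm_le_pi_norm h y) (hQ x y)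

lemma le_one_of_forall_le [Nonempty X] (hrow : M *ᵥ 1 = 1) (hε : 0 ≤ ε)
    (hlb : ∀ x y, ε ≤ M x y) : ε ≤ 1 := by
  obtain ⟨x⟩ := ‹Nonempty X›
  have h1 : ∑ y, M x y = 1 := by simpa [mulVec, dotProduct] using congrFun hrow x
  exact (hlb x x).trans
    (h1 ▸ Finset.single_le_sum (fun i _ => hε.trans (hlb x i)) (Finset.mem_univ x))

lemma dotProduct_sub_smul_one (hp1 : p ⬝ᵥ 1 = 1) (e : X → ℝ) (a : ℝ) :
    p ⬝ᵥ (e - a • 1) = p ⬝ᵥ e - a := by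
  rw [dotProduct_sub, dotProduct_smul, hp1, smul_eq_mul, mul_one]

/-- Perturbation identity for stationary measures, through a solution of the Poisson equation. -/
lemma dotProduct_sub_eq_of_poisson {N : Matrix X X ℝ} {q g e : X → ℝ} {a : ℝ}
    (hq1 : q ⬝ᵥ 1 = 1) (hq : q ᵥ* N = q) (hg : g - M *ᵥ g = e - a • 1) :
    q ⬝ᵥ e - a = ∑ x, q x * ((N - M) *ᵥ g) x := by
  have hqg : q ⬝ᵥ g = q ⬝ᵥ (N *ᵥ g) := by rw [dotProduct_mulVec, hq]
  rw [← dotProduct_sub_smul_one hq1, ← hg, dotProduct_sub, hqg, ← dotProduct_sub, ← sub_mulVec]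
  rfl

variable [DecidableEq X]

lemma dotProduct_pow_mulVec (hstat : p ᵥ* M = p) (h : X → ℝ) (t : ℕ) :
    p ⬝ᵥ (M ^ t *ᵥ h) = p ⬝ᵥ h := by
  induction t with
  | zero => simp
  | succ t ih => rw [pow_succ', ← mulVec_mulVec, dotProduct_mulVec, hstat, ih]

lemma pow_mulVec_one (hrow : M *ᵥ 1 = 1) (t : ℕ) : M ^ t *ᵥ 1 = 1 := by
  induction t with
  | zero => simp
  | succ t ih => rw [pow_succ, ← mulVec_mulVec, hrow, ih]

lemma norm_pow_mulVec_le [Nonempty X] (hrow : M *ᵥ 1 = 1) (hε : 0 ≤ ε)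
    (hlb : ∀ x y, ε ≤ M x y) (hp0 : ∀ x, 0 ≤ p x) (hp1 : p ⬝ᵥ 1 = 1) (hstat : p ᵥ* M = p)
    (hh : p ⬝ᵥ h = 0) (t : ℕ) : ‖M ^ t *ᵥ h‖ ≤ (1 - ε) ^ t * ‖h‖ := by
  induction t with
  | zero => simp
  | succ t ih =>
    rw [pow_succ', ← mulVec_mulVec, pow_succ', mul_assoc]
    refine (norm_mulVec_le_of_le hrow hε hlb hp0 hp1
      ((dotProduct_pow_mulVec hstat h t).trans hh)).trans ?_
    exact mul_le_mul_of_nonneg_left ih (sub_nonneg.2 (le_one_of_forall_le hrow hε hlb))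

/-- A solution of the Poisson equation `g - M g = h` for centered `h`, as the limit of the
partial sums of `M ^ t h`. -/
lemma exists_hasSum_pow_mulVec [Nonempty X] (hrow : M *ᵥ 1 = 1) (hε : 0 < ε)
    (hlb : ∀ x y, ε ≤ M x y) (hp0 : ∀ x, 0 ≤ p x) (hp1 : p ⬝ᵥ 1 = 1) (hstat : p ᵥ* M = p)
    (hh : p ⬝ᵥ h = 0) :
    ∃ g : X → ℝ, HasSum (fun t : ℕ => M ^ t *ᵥ h) g ∧ g - M *ᵥ g = h := by
  have hε1 := le_one_of_forall_le hrow hε.le hlb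
  have hs : Summable fun t : ℕ => M ^ t *ᵥ h :=
    .of_norm_bounded
      ((summable_geometric_of_lt_one (sub_nonneg.2 hε1) (by linarith)).mul_right ‖h‖)
      (norm_pow_mulVec_le hrow hε.le hlb hp0 hp1 hstat hh)
  refine ⟨_, hs.hasSum, ?_⟩
  have hM : HasSum (fun t : ℕ => M ^ (t + 1) *ᵥ h) (M *ᵥ ∑' t : ℕ, M ^ t *ᵥ h) := by
    simpa [Function.comp_def, pow_succ'] using
      hs.hasSum.map (Matrix.mulVecLin M) (by fun_prop : Continuous fun v : X → ℝ => M *ᵥ v)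
  rw [sub_eq_iff_eq_add, ← hM.tsum_eq, hs.tsum_eq_zero_add, pow_zero, one_mulVec]

lemma tendsto_pow_mulVec [Nonempty X] (hrow : M *ᵥ 1 = 1) (hε : 0 < ε)
    (hlb : ∀ x y, ε ≤ M x y) (hp0 : ∀ x, 0 ≤ p x) (hp1 : p ⬝ᵥ 1 = 1) (hstat : p ᵥ* M = p)
    (e : X → ℝ) : Tendsto (fun t : ℕ => M ^ t *ᵥ e) atTop (𝓝 ((p ⬝ᵥ e) • 1)) := by
  obtain ⟨g, hg, -⟩ := exists_hasSum_pow_mulVec hrow hε hlb hp0 hp1 hstat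
    ((dotProduct_sub_smul_one hp1 e (p ⬝ᵥ e)).trans (sub_self _))
  have h0 := hg.summable.tendsto_atTop_zero
  simp only [mulVec_sub, mulVec_smul, pow_mulVec_one hrow] at h0
  exact tendsto_sub_nhds_zero_iff.1 h0

end Doeblin

lemma HasDerivAt.continuousAt_mul_of_eq_zero {u v : ℝ → ℝ} {v' a : ℝ} (hv : HasDerivAt v v' a)
    (hu : ContinuousAt u a) (h0 : v a = 0) : HasDerivAt (fun t => u t * v t) (u a * v') a := by
  rw [hasDerivAt_iff_tendsto_slope] at hv ⊢
  refine ((hu.mono_left nhdsWithin_le_nhds).mul hv).congr fun t => ?_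
  simp only [slope_def_field, h0]
  ring

/-- Let `(P_θ)` be a family of Markov kernels on a finite set
`X` with differentiable entries and a uniform lower bound `ε > 0`, and let
`π_θ` be the (unique) stationary measure of `P_θ`. Fix `θ₀`, and suppose
`(c, P⁺, P⁻)` is a measure-valued derivative of `P_θ` at `θ₀`:
`(d/dθ)P_θ(x,y)∣_{θ₀} = c(x)(P⁺(x,y) − P⁻(x,y))` with `P⁺, P⁻` Markov kernels.
Then for every cost function `e` and every initial probability measure `μ`,
the derivative `D` of `θ ↦ π_θ(e)` at `θ₀` satisfies
`D = lim_{M⁰,M¹→∞} ∑ x, (μP_{θ₀}^{M⁰})(x) c(x)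
  ∑_{t=1}^{M¹} [∑ y, P⁺(x,y)(P_{θ₀}^{t−1}e)(y) − ∑ y, P⁻(x,y)(P_{θ₀}^{t−1}e)(y)]`,
where `(P^t e)(y) = ∑ z, P^t(y,z) e(z)`. -/
theorem mvd_stationary_derivative_limit
    {X : Type*} [Fintype X] [Nonempty X] [DecidableEq X]
    (P : ℝ → X → X → ℝ)
    (hProw : ∀ θ x, ∑ y, P θ x y = 1)
    (hPdiff : ∀ x y, Differentiable ℝ fun θ => P θ x y)
    (ε : ℝ) (hε : 0 < ε) (hPlb : ∀ θ x y, ε ≤ P θ x y)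
    (π : ℝ → X → ℝ)
    (hπ0 : ∀ θ x, 0 ≤ π θ x) (hπ1 : ∀ θ, ∑ x, π θ x = 1)
    (hπstat : ∀ θ y, ∑ x, π θ x * P θ x y = π θ y)
    (θ₀ : ℝ) (c : X → ℝ) (Pp Pm : X → X → ℝ)
    (hPp0 : ∀ x y, 0 ≤ Pp x y) (hPp1 : ∀ x, ∑ y, Pp x y = 1)
    (hPm0 : ∀ x y, 0 ≤ Pm x y) (hPm1 : ∀ x, ∑ y, Pm x y = 1)
    (hmvd : ∀ x y, HasDerivAt (fun θ => P θ x y) (c x * (Pp x y - Pm x y)) θ₀)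
    (e : X → ℝ)
    (μ : X → ℝ) (hμ0 : ∀ x, 0 ≤ μ x) (hμ1 : ∑ x, μ x = 1) :
    ∃ D : ℝ,
      HasDerivAt (fun θ => ∑ x, e x * π θ x) D θ₀ ∧
      Filter.Tendsto
        (fun M : ℕ × ℕ =>
          ∑ x, (∑ z, μ z * kernelPow (P θ₀) M.1 z x) * c x *
            ∑ t ∈ Finset.Icc 1 M.2,
              ((∑ y, Pp x y * ∑ z, kernelPow (P θ₀) (t - 1) y z * e z) -
                ∑ y, Pm x y * ∑ z, kernelPow (P θ₀) (t - 1) y z * e z))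
        Filter.atTop (nhds D) := by
  have hrow (θ : ℝ) : Matrix.of (P θ) *ᵥ 1 = 1 := by
    ext x; simpa [mulVec, dotProduct] using hProw θ x
  have hπ1' (θ : ℝ) : π θ ⬝ᵥ 1 = 1 := by simpa [dotProduct] using hπ1 θ
  have hstat (θ : ℝ) : π θ ᵥ* Matrix.of (P θ) = π θ := funext (hπstat θ)
  have hpoisson (f : X → ℝ) := exists_hasSum_pow_mulVec (hrow θ₀) hε (hPlb θ₀) (hπ0 θ₀) (hπ1' θ₀)
    (hstat θ₀) ((dotProduct_sub_smul_one (hπ1' θ₀) f (π θ₀ ⬝ᵥ f)).trans (sub_self _))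
  have hmv (g : X → ℝ) (x : X) :
      HasDerivAt (fun θ => ((Matrix.of (P θ) - Matrix.of (P θ₀)) *ᵥ g) x)
        (c x * ∑ y, (Pp x y - Pm x y) * g y) θ₀ := by
    simp only [mulVec, dotProduct, Matrix.sub_apply, Matrix.of_apply, Finset.mul_sum, ← mul_assoc]
    exact .fun_sum fun y _ => ((hmvd x y).sub_const _).mul_const _
  have hcont (x : X) : ContinuousAt (fun θ => π θ x) θ₀ := by
    obtain ⟨g, -, hg⟩ := hpoisson (Pi.single x 1)
    have key (θ : ℝ) := dotProduct_sub_eq_of_poisson (hπ1' θ) (hstat θ) hg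
    simp only [dotProduct_single, mul_one] at key
    have hlim : Tendsto (fun θ => ∑ z, π θ z * ((Matrix.of (P θ) - Matrix.of (P θ₀)) *ᵥ g) z)
        (𝓝 θ₀) (𝓝 0) := by
      rw [← Finset.sum_const_zero (s := (Finset.univ : Finset X))]
      refine tendsto_finsetSum _ fun z _ => ?_
      have hz := (hmv g z).continuousAt.tendsto
      simp only [sub_self, zero_mulVec, Pi.zero_apply] at hz
      refine squeeze_zero_norm (fun θ => ?_) (norm_zero (E := ℝ) ▸ hz.norm)
      rw [norm_mul, Real.norm_of_nonneg (hπ0 θ z)]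
      exact mul_le_of_le_one_left (norm_nonneg _)
        (hπ1 θ ▸ Finset.single_le_sum (fun i _ => hπ0 θ i) (Finset.mem_univ z))
    simp only [← key] at hlim
    exact tendsto_sub_nhds_zero_iff.1 hlim
  obtain ⟨g, hsum, hg⟩ := hpoisson e
  refine ⟨∑ x, π θ₀ x * (c x * ∑ y, (Pp x y - Pm x y) * g y), ?_, ?_⟩
  · have hd : HasDerivAt
        (fun θ => ∑ x, π θ x * ((Matrix.of (P θ) - Matrix.of (P θ₀)) *ᵥ g) x)
        (∑ x, π θ₀ x * (c x * ∑ y, (Pp x y - Pm x y) * g y)) θ₀ :=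
      .fun_sum fun x _ => (hmv g x).continuousAt_mul_of_eq_zero (hcont x) (by simp)
    refine (hd.add_const (π θ₀ ⬝ᵥ e)).congr_of_eventuallyEq (.of_forall fun θ => ?_)
    beta_reduce
    rw [← dotProduct_sub_eq_of_poisson (hπ1' θ) (hstat θ) hg, sub_add_cancel, dotProduct_comm]
    rfl
  · simp only [← prod_atTop_atTop_eq, kernelPow_eq_pow, mul_assoc]
    refine tendsto_finsetSum _ fun x _ => .mul ?_ (.const_mul _ ?_)
    · have hx (z : X) : Tendsto (fun t : ℕ => (Matrix.of (P θ₀) ^ t) z x) atTop (𝓝 (π θ₀ x)) := by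
        simpa using tendsto_pi_nhds.1 (tendsto_pow_mulVec (hrow θ₀) hε (hPlb θ₀) (hπ0 θ₀)
          (hπ1' θ₀) (hstat θ₀) (Pi.single x 1)) z
      have hμ := tendsto_finsetSum Finset.univ fun z (_ : z ∈ Finset.univ) => (hx z).const_mul (μ z)
      rw [← Finset.sum_mul, hμ1, one_mul] at hμ
      exact hμ.comp tendsto_fst
    · refine Tendsto.comp (g := fun n : ℕ => ∑ t ∈ Finset.Icc 1 n,
        ((∑ y, Pp x y * ∑ z, (Matrix.of (P θ₀) ^ (t - 1)) y z * e z) -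
          ∑ y, Pm x y * ∑ z, (Matrix.of (P θ₀) ^ (t - 1)) y z * e z)) ?_ tendsto_snd
      have hs (y : X) := Pi.hasSum.1 hsum y
      have hL := (hasSum_sum fun y (_ : y ∈ Finset.univ) =>
        (hs y).mul_left (Pp x y - Pm x y)).tendsto_sum_nat
      refine hL.congr fun n => ?_
      rw [← Finset.Ico_add_one_right_eq_Icc, Finset.sum_Ico_eq_sum_range]
      refine Finset.sum_congr (by simp) fun t _ => ?_
      simp only [add_tsub_cancel_left, mulVec_sub, mulVec_smul, pow_mulVec_one (hrow θ₀),
        Pi.sub_apply, Pi.smul_apply, Pi.one_apply, smul_eq_mul, mul_one, mul_sub,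
        Finset.sum_sub_distrib, ← Finset.sum_mul, hPp1, hPm1, sub_mul, one_mul, sub_self, sub_zero]
      rfl
end
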